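/- Assume the quantum Jacobi–Trudi identity T_{λ⊂μ}(u) = det_{1≤i,j≤μ_1}( T^{μ′_i−λ′_j−i+j}(u−μ_1+μ′_1−μ′_i−λ′_j+i+j−1) ) holds for all skew Young diagrams. Then for every integer a ≥ r+2: T_{s+1}^a(u−1)·T_{s+1}^a(u+1) = g_{s+1}^a(u)·T_{s+1}^{a−1}(u)·T_{s+1}^{a+1}(u), where g_m^1(u) := ∏_{j=1}^{m} P_1(u−m+2j−2) for m ≥ 1 and g_m^a(u) := 1 for a ≥ 2 (so g_{s+1}^a(u) = 1 here since a ≥ r+2 ≥ 2). -/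

import Mathlib

/-!
Analytic Bethe ansatz for the Lie superalgebra `sl(r+1|s+1)` (Z. Tsuboi,
J. Phys. A: Math. Gen. 30 (1997) 7975-7991).  Common definitions.
-/

open scoped Classical
open Filter Topology

noncomputable section

namespace Tsuboi

/-- The bracket `[u] = sinh(ηu)/sinh(η)`. -/
def br (η u : ℂ) : ℂ := Complex.sinh (η * u) / Complex.sinh η

/-- `P₁(u) = ∏_{j=1}^{N} [u - w_j]`. -/
def Pf (η : ℂ) (N : ℕ) (w : ℕ → ℂ) (u : ℂ) : ℂ :=
  ∏ j ∈ Finset.range N, br η (u - w j)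

/-- `Q_a(u) = ∏_{j=1}^{N_a} [u - u_j^{(a)}]`, with the conventions
`Q_0 = Q_{r+s+2} = 1`. -/
def Qf (r s : ℕ) (η : ℂ) (Nb : ℕ → ℕ) (rt : ℕ → ℕ → ℂ) (a : ℕ) (u : ℂ) : ℂ :=
  if a = 0 ∨ a = r + s + 2 then 1
  else ∏ j ∈ Finset.range (Nb a), br η (u - rt a j)

/-- The vacuum factor `ψ_a(u)`. -/
def ψf (η : ℂ) (N : ℕ) (w : ℕ → ℂ) (a : ℕ) (u : ℂ) : ℂ :=
  if a = 1 then Pf η N w (u + 2) else Pf η N w u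

/-- The box function `z(a;u)`, for `a ∈ J = {1,…,r+s+2}` (first branch `J₊`,
second branch `J₋`). -/
def zf (r s : ℕ) (η : ℂ) (Nb : ℕ → ℕ) (rt : ℕ → ℕ → ℂ) (N : ℕ) (w : ℕ → ℂ)
    (a : ℕ) (u : ℂ) : ℂ :=
  if a ≤ r + 1 then
    ψf η N w a u * Qf r s η Nb rt (a - 1) (u + a + 1) * Qf r s η Nb rt a (u + a - 2) /
      (Qf r s η Nb rt (a - 1) (u + a - 1) * Qf r s η Nb rt a (u + a))
  else
    ψf η N w a u * Qf r s η Nb rt (a - 1) (u + 2 * r - a + 1) *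
        Qf r s η Nb rt a (u + 2 * r - a + 4) /
      (Qf r s η Nb rt (a - 1) (u + 2 * r - a + 3) * Qf r s η Nb rt a (u + 2 * r - a + 2))

/-- The sign `(-1)^{p(a)}` for `a ∈ J`. -/
def sgn (r : ℕ) (a : ℕ) : ℂ := if a ≤ r + 1 then 1 else -1

/-- The denominator of `z(a;u)`. -/
def zDen (r s : ℕ) (η : ℂ) (Nb : ℕ → ℕ) (rt : ℕ → ℕ → ℂ) (a : ℕ) (u : ℂ) : ℂ :=
  if a ≤ r + 1 then
    Qf r s η Nb rt (a - 1) (u + a - 1) * Qf r s η Nb rt a (u + a)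
  else
    Qf r s η Nb rt (a - 1) (u + 2 * r - a + 3) * Qf r s η Nb rt a (u + 2 * r - a + 2)

/-- The pairing `(α_a|α_b)` for the distinguished simple roots of `sl(r+1|s+1)`. -/
def cart (r : ℕ) (a b : ℕ) : ℤ :=
  if a = b then (if a ≤ r then 2 else if a = r + 1 then 0 else -2)
  else if b = a + 1 ∨ a = b + 1 then (if min a b ≤ r then -1 else 1)
  else 0

/-- The Bethe ansatz equations for the distinguished simple root system, with
quantum space labelled by the Young diagram `(1)`. -/
def BAE (r s : ℕ) (η : ℂ) (Nb : ℕ → ℕ) (rt : ℕ → ℕ → ℂ) (N : ℕ) (w : ℕ → ℂ) : Prop :=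
  ∀ a ∈ Finset.Icc 1 (r + s + 1), ∀ k < Nb a,
    -((if a = 1 then Pf η N w (rt a k + (if a ≤ r + 1 then 1 else -1)) else 1) /
        (if a = 1 then Pf η N w (rt a k - (if a ≤ r + 1 then 1 else -1)) else 1)) =
      (if a = r + 1 then -1 else 1) *
        ∏ b ∈ Finset.Icc 1 (r + s + 1),
          Qf r s η Nb rt b (rt a k + (cart r a b : ℂ)) /
            Qf r s η Nb rt b (rt a k - (cart r a b : ℂ))

/-- Genericity of the Bethe roots: no two of the (shifted) roots collide with
each other (so all poles of the `z`-functions are simple) and the roots stay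
away from the inhomogeneities `w_i` (no other factor vanishes at a pole). -/
def Generic (r s : ℕ) (η : ℂ) (Nb : ℕ → ℕ) (rt : ℕ → ℕ → ℂ) (N : ℕ) (w : ℕ → ℂ) : Prop :=
  (∀ c ∈ Finset.Icc 1 (r + s + 1), ∀ c' ∈ Finset.Icc 1 (r + s + 1),
      ∀ j < Nb c, ∀ j' < Nb c', ∀ m : ℤ,
        ((c, j) ≠ (c', j') ∨ m ≠ 0) → br η (rt c j - rt c' j' + (m : ℂ)) ≠ 0) ∧
  (∀ c ∈ Finset.Icc 1 (r + s + 1), ∀ j < Nb c, ∀ i < N, ∀ m : ℤ,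
      br η (rt c j - w i + (m : ℂ)) ≠ 0)

/-- A skew Young diagram `λ ⊂ μ` (rows indexed from 1, at most `d` nonempty rows). -/
structure Skew where
  lam : ℕ → ℕ
  mu : ℕ → ℕ
  d : ℕ
  sub : ∀ i, lam i ≤ mu i
  lam_anti : ∀ i j, 1 ≤ i → i ≤ j → lam j ≤ lam i
  mu_anti : ∀ i j, 1 ≤ i → i ≤ j → mu j ≤ mu i
  bound : ∀ i, d < i → mu i = 0

/-- `(i,j)` is a cell of the skew diagram `μ∖λ`. -/
def Skew.cell (D : Skew) (i j : ℕ) : Prop := 1 ≤ i ∧ D.lam i < j ∧ j ≤ D.mu i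

/-- The conjugate partition `μ′`. -/
def Skew.conjMu (D : Skew) (j : ℕ) : ℕ :=
  ((Finset.Icc 1 D.d).filter fun i => j ≤ D.mu i).card

/-- The conjugate partition `λ′`. -/
def Skew.conjLam (D : Skew) (j : ℕ) : ℕ :=
  ((Finset.Icc 1 D.d).filter fun i => j ≤ D.lam i).card

/-- Admissibility of a tableau on the skew diagram `λ ⊂ μ`:  entries (the value
at a cell `(i,j)` is `t (i-1, j-1) + 1 ∈ J`) weakly increase along rows and
columns, entries from `J₊` strictly increase down columns, entries from `J₋`
strictly increase along rows; off-cell values are normalised to `0`. -/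
def Adm (r s : ℕ) (D : Skew) (t : Fin D.d × Fin (D.mu 1) → Fin (r + s + 2)) : Prop :=
  (∀ p, ¬ D.cell (p.1.1 + 1) (p.2.1 + 1) → (t p : ℕ) = 0) ∧
  ∀ p q, D.cell (p.1.1 + 1) (p.2.1 + 1) → D.cell (q.1.1 + 1) (q.2.1 + 1) →
    ((q.1.1 = p.1.1 ∧ q.2.1 = p.2.1 + 1 →
        (t p : ℕ) ≤ (t q : ℕ) ∧ (r + 2 ≤ (t p : ℕ) + 1 → (t p : ℕ) < (t q : ℕ))) ∧
     (q.1.1 = p.1.1 + 1 ∧ q.2.1 = p.2.1 →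
        (t p : ℕ) ≤ (t q : ℕ) ∧ ((t p : ℕ) + 1 ≤ r + 1 → (t p : ℕ) < (t q : ℕ))))

/-- The normalisation function `F^a(u)` (for `a ≥ 0`). -/
def Fa (η : ℂ) (N : ℕ) (w : ℕ → ℂ) (a : ℕ) (u : ℂ) : ℂ :=
  if a = 0 then 1 / Pf η N w (u - 1)
  else ∏ j ∈ Finset.Icc 1 (a - 1), Pf η N w (u - 2 * (j : ℂ) + (a : ℂ) - 1)

/-- The normalisation `F_{λ⊂μ}(u)`. -/
def Fskew (η : ℂ) (N : ℕ) (w : ℕ → ℂ) (D : Skew) (u : ℂ) : ℂ :=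
  ∏ j ∈ Finset.Icc 1 (D.mu 1),
    Fa η N w (D.conjMu j - D.conjLam j)
      (u + (D.conjMu 1 : ℂ) - (D.mu 1 : ℂ) - (D.conjMu j : ℂ) - (D.conjLam j : ℂ)
        + 2 * (j : ℂ) - 1)

/-- The dressed-vacuum-form eigenvalue `𝒯_{λ⊂μ}(u)`, a sum over the admissible
tableaux on `λ ⊂ μ`. -/
def Tskew (r s : ℕ) (η : ℂ) (Nb : ℕ → ℕ) (rt : ℕ → ℕ → ℂ) (N : ℕ) (w : ℕ → ℂ)
    (D : Skew) (u : ℂ) : ℂ :=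
  (Fskew η N w D u)⁻¹ *
    ∑ t ∈ Finset.univ.filter (Adm r s D),
      ∏ p : Fin D.d × Fin (D.mu 1),
        if D.cell (p.1.1 + 1) (p.2.1 + 1) then
          sgn r ((t p : ℕ) + 1) *
            zf r s η Nb rt N w ((t p : ℕ) + 1)
              (u - (D.mu 1 : ℂ) + (D.conjMu 1 : ℂ) - 2 * ((p.1.1 : ℂ) + 1)
                + 2 * ((p.2.1 : ℂ) + 1))
        else 1

/-- The rectangular diagram `(m^a)` (`a` rows, `m` columns). -/
def rect (a m : ℕ) : Skew where
  lam := fun _ => 0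
  mu := fun i => if 1 ≤ i ∧ i ≤ a then m else 0
  d := a
  sub := fun _ => Nat.zero_le _
  lam_anti := fun _ _ _ _ => le_rfl
  mu_anti := by
    intro i j hi hij
    by_cases hj : 1 ≤ j ∧ j ≤ a
    · have hi' : 1 ≤ i ∧ i ≤ a := ⟨hi, le_trans hij hj.2⟩
      simp [hj, hi']
    · simp only [if_neg hj]
      exact Nat.zero_le _
  bound := by
    intro i hi
    have h : ¬ (1 ≤ i ∧ i ≤ a) := by omega
    simp [h]

/-- `𝒯_m^a(u) = 𝒯_{(m^a)}(u)`. -/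
def Trect (r s : ℕ) (η : ℂ) (Nb : ℕ → ℕ) (rt : ℕ → ℕ → ℂ) (N : ℕ) (w : ℕ → ℂ)
    (a m : ℕ) (u : ℂ) : ℂ :=
  Tskew r s η Nb rt N w (rect a m) u

/-- `𝒯^a(u)` for `a : ℤ`:  `𝒯^a = 𝒯_{(1^a)}` for `a ≥ 1`, `𝒯^0(u) = P_1(u-1)`,
`𝒯^a = 0` for `a < 0`. -/
def TaA (r s : ℕ) (η : ℂ) (Nb : ℕ → ℕ) (rt : ℕ → ℕ → ℂ) (N : ℕ) (w : ℕ → ℂ)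
    (a : ℤ) (u : ℂ) : ℂ :=
  if a < 0 then 0
  else if a = 0 then Pf η N w (u - 1)
  else Tskew r s η Nb rt N w (rect a.toNat 1) u

/-- `𝒯_m(u)` for `m : ℤ`:  `𝒯_m = 𝒯_{(m)}` for `m ≥ 1`, `𝒯_0 = 1`,
`𝒯_m = 0` for `m < 0`. -/
def TmA (r s : ℕ) (η : ℂ) (Nb : ℕ → ℕ) (rt : ℕ → ℕ → ℂ) (N : ℕ) (w : ℕ → ℂ)
    (m : ℤ) (u : ℂ) : ℂ :=
  if m < 0 then 0
  else if m = 0 then 1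
  else Tskew r s η Nb rt N w (rect 1 m.toNat) u

/-- The quantum Jacobi–Trudi identity (column form) for all skew diagrams. -/
def JTcol (r s : ℕ) (η : ℂ) (Nb : ℕ → ℕ) (rt : ℕ → ℕ → ℂ) (N : ℕ) (w : ℕ → ℂ) : Prop :=
  ∀ (D : Skew) (u : ℂ),
    Tskew r s η Nb rt N w D u =
      Matrix.det (Matrix.of fun i j : Fin (D.mu 1) =>
        TaA r s η Nb rt N w
          ((D.conjMu (i.1 + 1) : ℤ) - (D.conjLam (j.1 + 1) : ℤ) - (i.1 + 1) + (j.1 + 1))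
          (u - (D.mu 1 : ℂ) + (D.conjMu 1 : ℂ) - (D.conjMu (i.1 + 1) : ℂ)
            - (D.conjLam (j.1 + 1) : ℂ) + ((i.1 : ℂ) + 1) + ((j.1 : ℂ) + 1) - 1))

/-- `g_m^a(u)`. -/
def gfun (η : ℂ) (N : ℕ) (w : ℕ → ℂ) (a m : ℕ) (u : ℂ) : ℂ :=
  if a = 1 then ∏ j ∈ Finset.Icc 1 m, Pf η N w (u - (m : ℂ) + 2 * (j : ℂ) - 2) else 1

/-- Weakly increasing sequences in `J` with no repeated entry from `J₊`
(the entry at `i` is `b i + 1 ∈ J`). -/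
def IncSeqCol (r s a : ℕ) (b : Fin a → Fin (r + s + 2)) : Prop :=
  ∀ (i : ℕ) (h : i + 1 < a),
    (b ⟨i, by omega⟩ : ℕ) ≤ (b ⟨i + 1, h⟩ : ℕ) ∧
    ((b ⟨i, by omega⟩ : ℕ) + 1 ≤ r + 1 → (b ⟨i, by omega⟩ : ℕ) < (b ⟨i + 1, h⟩ : ℕ))

/-- Weakly increasing sequences in `J` with no repeated entry from `J₋`. -/
def IncSeqRow (r s m : ℕ) (b : Fin m → Fin (r + s + 2)) : Prop :=
  ∀ (i : ℕ) (h : i + 1 < m),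
    (b ⟨i, by omega⟩ : ℕ) ≤ (b ⟨i + 1, h⟩ : ℕ) ∧
    (r + 2 ≤ (b ⟨i, by omega⟩ : ℕ) + 1 → (b ⟨i, by omega⟩ : ℕ) < (b ⟨i + 1, h⟩ : ℕ))

/-- `ℱ^a(u)·𝒯^a(u) = Σ_{b_1 ≼ … ≼ b_a} ∏_i (−1)^{p(b_i)} z(b_i; u+a+1−2i)`. -/
def colSum (r s : ℕ) (η : ℂ) (Nb : ℕ → ℕ) (rt : ℕ → ℕ → ℂ) (N : ℕ) (w : ℕ → ℂ)
    (a : ℕ) (u : ℂ) : ℂ :=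
  ∑ b ∈ Finset.univ.filter (IncSeqCol r s a),
    ∏ i : Fin a,
      sgn r ((b i : ℕ) + 1) *
        zf r s η Nb rt N w ((b i : ℕ) + 1) (u + (a : ℂ) + 1 - 2 * ((i.1 : ℂ) + 1))

/-- `𝒯_m(u) = Σ_{b_1 ≼ … ≼ b_m} ∏_j (−1)^{p(b_j)} z(b_j; u−m−1+2j)`. -/
def rowSum (r s : ℕ) (η : ℂ) (Nb : ℕ → ℕ) (rt : ℕ → ℕ → ℂ) (N : ℕ) (w : ℕ → ℂ)
    (m : ℕ) (u : ℂ) : ℂ :=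
  ∑ b ∈ Finset.univ.filter (IncSeqRow r s m),
    ∏ j : Fin m,
      sgn r ((b j : ℕ) + 1) *
        zf r s η Nb rt N w ((b j : ℕ) + 1) (u - (m : ℂ) - 1 + 2 * ((j.1 : ℂ) + 1))

end Tsuboi

namespace Tsuboi

/-- The adjugate of a singular matrix has vanishing `2 × 2` minors. -/
theorem adjugate_mul_adjugate_of_det_eq_zero {n K : Type*} [Fintype n] [DecidableEq n] [Field K]
    {A : Matrix n n K} (hA : A.det = 0) (i j k l : n) :
    A.adjugate i k * A.adjugate j l = A.adjugate i l * A.adjugate j k := by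
  set x : n → K := fun p => A.adjugate i k * A.adjugate p l - A.adjugate i l * A.adjugate p k
    with hx
  have hAx : A.mulVec x = 0 := by
    have hmul : ∀ p q, ∑ t, A p t * A.adjugate t q = 0 := fun p q => by
      simpa [Matrix.mul_apply, hA] using congrFun (congrFun A.mul_adjugate p) q
    funext p
    calc A.mulVec x p
        = A.adjugate i k * ∑ t, A p t * A.adjugate t l
            - A.adjugate i l * ∑ t, A p t * A.adjugate t k := by
          simp only [Matrix.mulVec, dotProduct, hx, Finset.mul_sum, ← Finset.sum_sub_distrib]
          exact Finset.sum_congr rfl fun t _ => by ring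
      _ = 0 := by simp [hmul]
  have hxi : x i = 0 := by simp only [hx]; ring
  by_cases hx0 : x = 0
  · exact sub_eq_zero.mp (congrFun hx0 j)
  · have hrow : ∀ q, A.adjugate i q = 0 := fun q => by
      rw [Matrix.adjugate_apply]
      refine Matrix.exists_mulVec_eq_zero_iff.mp ⟨x, hx0, ?_⟩
      funext p
      rcases eq_or_ne p q with rfl | hpq
      · simp [Matrix.mulVec, hxi]
      · simpa [Matrix.mulVec, Matrix.updateRow_ne hpq] using congrFun hAx p
    simp [hrow]

/-- The Desnanot–Jacobi identity for a singular matrix. -/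
theorem det_submatrix_mul_det_submatrix_of_det_eq_zero {K : Type*} [Field K] {n : ℕ}
    {A : Matrix (Fin (n + 1)) (Fin (n + 1)) K} (hA : A.det = 0) :
    (A.submatrix Fin.castSucc Fin.castSucc).det * (A.submatrix Fin.succ Fin.succ).det =
      (A.submatrix Fin.succ Fin.castSucc).det * (A.submatrix Fin.castSucc Fin.succ).det := by
  have h := adjugate_mul_adjugate_of_det_eq_zero hA (Fin.last n) 0 (Fin.last n) 0
  simp only [Matrix.adjugate_fin_succ_eq_det_submatrix, Fin.succAbove_last,
    Fin.succAbove_zero, Fin.val_last, Fin.val_zero, zero_add, add_zero, pow_zero, one_mul,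
    Even.neg_one_pow (⟨n, rfl⟩ : Even (n + n))] at h
  rw [h, mul_mul_mul_comm, ← pow_add, Even.neg_one_pow ⟨n, rfl⟩, one_mul]

theorem rect_mu_one {a : ℕ} (ha : 1 ≤ a) (m : ℕ) : (rect a m).mu 1 = m := by
  simp [rect, ha]

theorem rect_conjMu {a m j : ℕ} (hjm : j ≤ m) : (rect a m).conjMu j = a := by
  have : (Finset.Icc 1 a).filter (fun i => j ≤ (rect a m).mu i) = Finset.Icc 1 a := by
    refine Finset.filter_true_of_mem fun i hi => ?_
    simpa [rect, Finset.mem_Icc.mp hi] using hjm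
  change ((Finset.Icc 1 a).filter _).card = a
  simp [this]

theorem rect_conjLam {a m j : ℕ} (hj : 1 ≤ j) : (rect a m).conjLam j = 0 := by
  simp only [Skew.conjLam, rect, Finset.card_eq_zero]
  exact Finset.filter_false_of_mem fun i _ => by omega

theorem rect_cell {a m i j : ℕ} (hi : 1 ≤ i) (hia : i ≤ a) (hj : 1 ≤ j) (hjm : j ≤ m) :
    (rect a m).cell i j := by
  simp only [Skew.cell, rect]
  simp [hi, hia, hjm]
  omega

/-- The Jacobi–Trudi determinant of a rectangular diagram. -/
theorem Trect_eq_det {r s : ℕ} {η : ℂ} {Nb : ℕ → ℕ} {rt : ℕ → ℕ → ℂ} {N : ℕ} {w : ℕ → ℂ}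
    (hJT : JTcol r s η Nb rt N w) {a m : ℕ} (ha : 1 ≤ a) (hm : 1 ≤ m) (u : ℂ) :
    Trect r s η Nb rt N w a m u =
      Matrix.det (Matrix.of fun i j : Fin m =>
        TaA r s η Nb rt N w ((a : ℤ) - i.1 + j.1) (u - m + i.1 + j.1 + 1)) := by
  have hmu := rect_mu_one ha m
  rw [Trect, hJT, ← Matrix.det_submatrix_equiv_self (finCongr hmu)]
  have hmuC : (((rect a m).mu 1 : ℕ) : ℂ) = m := congrArg _ hmu
  congr 1
  ext i j
  have hi : i.1 < m := i.2.trans_eq hmu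
  simp only [Matrix.of_apply, Matrix.submatrix_apply, finCongr_apply, Fin.val_cast]
  rw [rect_conjMu (j := i.1 + 1) (by omega), rect_conjLam (by omega),
    rect_conjMu hm, hmuC]
  congr 1 <;> push_cast <;> ring

/-- There is no admissible tableau on a rectangle that leaves the fat hook. -/
theorem not_adm_rect {r s a m : ℕ} (ha : r + 2 ≤ a) (hm : s + 2 ≤ m)
    (t : Fin (rect a m).d × Fin ((rect a m).mu 1) → Fin (r + s + 2)) :
    ¬ Adm r s (rect a m) t := by
  rintro ⟨-, ht⟩
  have hmu : (rect a m).mu 1 = m := rect_mu_one (by omega) m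
  have hd : (rect a m).d = a := rfl
  have hcol : ∀ (i : ℕ) (hi : i < r + 2),
      i ≤ (t (⟨i, by omega⟩, ⟨0, by omega⟩) : ℕ) := by
    intro i
    induction i with
    | zero => simp
    | succ i ih =>
      intro hi
      have h := (ht (⟨i, by omega⟩, ⟨0, by omega⟩) (⟨i + 1, by omega⟩, ⟨0, by omega⟩)
        (rect_cell (by simp) (by simp; omega) (by simp) (by simp; omega))
        (rect_cell (by simp) (by simp; omega) (by simp) (by simp; omega))).2 ⟨rfl, rfl⟩
      have := ih (by omega)
      omega
  have hrow : ∀ (j : ℕ) (hj : j < s + 2),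
      r + 1 + j ≤ (t (⟨r + 1, by omega⟩, ⟨j, by omega⟩) : ℕ) := by
    intro j
    induction j with
    | zero => exact fun _ => hcol (r + 1) (by omega)
    | succ j ih =>
      intro hj
      have h := (ht (⟨r + 1, by omega⟩, ⟨j, by omega⟩) (⟨r + 1, by omega⟩, ⟨j + 1, by omega⟩)
        (rect_cell (by simp) (by simp; omega) (by simp) (by simp; omega))
        (rect_cell (by simp) (by simp; omega) (by simp) (by simp; omega))).1 ⟨rfl, rfl⟩
      have := ih (by omega)
      omega
  have := hrow (s + 1) (by omega)
  have := (t (⟨r + 1, by omega⟩, ⟨s + 1, by omega⟩)).2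
  omega

theorem Trect_eq_zero {r s a m : ℕ} (ha : r + 2 ≤ a) (hm : s + 2 ≤ m)
    (η : ℂ) (Nb : ℕ → ℕ) (rt : ℕ → ℕ → ℂ) (N : ℕ) (w : ℕ → ℂ) (u : ℂ) :
    Trect r s η Nb rt N w a m u = 0 := by
  rw [Trect, Tskew, Finset.filter_false_of_mem fun t _ => not_adm_rect ha hm t,
    Finset.sum_empty, mul_zero]

/-- Assuming the quantum Jacobi–Trudi identity, for every
`a ≥ r+2`:
`𝒯_{s+1}^a(u−1)𝒯_{s+1}^a(u+1) = g_{s+1}^a(u)𝒯_{s+1}^{a−1}(u)𝒯_{s+1}^{a+1}(u)`. -/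
theorem laplace_col
    (r s : ℕ) (η : ℂ) (hη : Complex.exp (2 * η) ≠ 1)
    (Nb : ℕ → ℕ) (rt : ℕ → ℕ → ℂ) (N : ℕ) (w : ℕ → ℂ)
    (hJT : JTcol r s η Nb rt N w)
    (a : ℕ) (ha : r + 2 ≤ a) (u : ℂ) :
    Trect r s η Nb rt N w a (s + 1) (u - 1) * Trect r s η Nb rt N w a (s + 1) (u + 1) =
      gfun η N w a (s + 1) u * Trect r s η Nb rt N w (a - 1) (s + 1) u *
        Trect r s η Nb rt N w (a + 1) (s + 1) u := by
  have hdet := Trect_eq_zero (m := s + 1 + 1) ha le_rfl η Nb rt N w u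
  rw [Trect_eq_det hJT (by omega) (by omega)] at hdet
  have hgfun : gfun η N w a (s + 1) u = 1 := if_neg (by omega)
  have hminors := det_submatrix_mul_det_submatrix_of_det_eq_zero hdet
  rw [hgfun, one_mul, Trect_eq_det hJT (by omega) (by omega),
    Trect_eq_det hJT (by omega) (by omega), Trect_eq_det hJT (by omega) (by omega),
    Trect_eq_det hJT (by omega) (by omega)]
  refine Eq.trans (congrArg₂ (· * ·) (congrArg Matrix.det ?_) (congrArg Matrix.det ?_))
    (hminors.trans (congrArg₂ (· * ·) (congrArg Matrix.det ?_) (congrArg Matrix.det ?_))) <;>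
    ext i j <;>
    simp only [Matrix.of_apply, Matrix.submatrix_apply, Fin.val_castSucc, Fin.val_succ] <;>
    refine congrArg₂ (TaA r s η Nb rt N w) ?_ ?_ <;>
    push_cast [Nat.cast_sub (show 1 ≤ a by omega)] <;> ring

end Tsuboi
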